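/- arXiv:2412.08118 — 3 statements merged into one kernel-verified Lean document; each statement's English description precedes it below -/
import Mathlib

section
/- Let 1 ≤ l ≤ n−1. There exist points z₁' ∈ V₁, …, z_l' ∈ V_l such that the l × l complex matrix (f_k'(z_j'))_{1≤k≤l, 1≤j≤l} is invertible (has nonzero determinant). In particular, there exist points z₁' ∈ V₁, …, z_{n−1}' ∈ V_{n−1} such that the (n−1) × (n−1) matrix (f_k'(z_j'))_{1≤k,j≤n−1} is invertible. -/
/-- A real-valued function on `ℂ` is harmonic on a set if it is `C²` there
and its Laplacian vanishes at every point of the set. -/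
def HarmonicOnSet (u : ℂ → ℝ) (s : Set ℂ) : Prop :=
  ContDiffOn ℝ 2 u s ∧ ∀ z ∈ s,
    fderiv ℝ (fun w => fderiv ℝ u w 1) z 1 +
      fderiv ℝ (fun w => fderiv ℝ u w Complex.I) z Complex.I = 0

open Complex Topology

/-- The Wirtinger-type derivative `∂u/∂x - i ∂u/∂y`. -/
noncomputable def complexPartial (u : ℂ → ℝ) (z : ℂ) : ℂ :=
  fderiv ℝ u z 1 - I * fderiv ℝ u z I

theorem HarmonicOnSet.harmonicAt {u : ℂ → ℝ} {s : Set ℂ} (h : HarmonicOnSet u s)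
    (hs : IsOpen s) {z : ℂ} (hz : z ∈ s) : InnerProductSpace.HarmonicAt u z := by
  refine ⟨h.1.contDiffAt (hs.mem_nhds hz), ?_⟩
  filter_upwards [hs.mem_nhds hz] with w hw
  have hd : DifferentiableAt ℝ (fderiv ℝ u) w :=
    ((h.1.contDiffAt (hs.mem_nhds hw)).fderiv_right (m := 1) (by norm_num)).differentiableAt
      (by norm_num)
  have key := h.2 w hw
  rw [fderiv_clm_apply hd (by fun_prop), fderiv_clm_apply hd (by fun_prop)] at key
  simpa [InnerProductSpace.laplacian_eq_iteratedFDeriv_complexPlane,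
    iteratedFDeriv_two_apply] using key

/-- If `g_1, …, g_l` are linearly independent on each of the sets `V_1, …, V_l`, then
points `z_j ∈ V_j` can be chosen such that the matrix `(g_k(z_j))` is invertible. -/
theorem exists_det_ne_zero_of_linearIndependent_on {K X : Type*} [Field K] :
    ∀ (l : ℕ) (g : Fin l → X → K) (V : Fin l → Set X)
      (_ : ∀ j (c : Fin l → K), (∀ z ∈ V j, ∑ k, c k * g k z = 0) → c = 0),
      ∃ z : Fin l → X, (∀ j, z j ∈ V j) ∧ (Matrix.of fun k j => g k (z j)).det ≠ 0
  | 0, _, _, _ => ⟨Fin.elim0, fun j => j.elim0, by simp⟩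
  | l + 1, g, V, h => by
    obtain ⟨z, hzV, hz⟩ := exists_det_ne_zero_of_linearIndependent_on l
      (fun k => g k.castSucc) (fun j => V j.castSucc) (fun j c hc => by
        have h0 := h j.castSucc (Fin.snoc c 0) (fun w hw => by
          simpa [Fin.sum_univ_castSucc] using hc w hw)
        funext k
        simpa using congrFun h0 k.castSucc)
    let c : Fin (l + 1) → K := fun k => (-1) ^ ((k : ℕ) + l) *
      (Matrix.of fun (i j : Fin l) => g (k.succAbove i) (z j)).det
    have hc : c ≠ 0 := fun h0 => by
      have := congrFun h0 (Fin.last l)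
      simp [c] at this
      exact hz this
    obtain ⟨w, hw, hw0⟩ : ∃ w ∈ V (Fin.last l), ∑ k, c k * g k w ≠ 0 := by
      by_contra! hcon
      exact hc (h _ c hcon)
    refine ⟨Fin.snoc z w, fun j => ?_, ?_⟩
    · refine Fin.lastCases ?_ (fun i => ?_) j
      · simpa using hw
      · simpa using hzV i
    · rw [Matrix.det_succ_column _ (Fin.last l)]
      refine ne_of_eq_of_ne (Finset.sum_congr rfl fun k _ => ?_) hw0
      have : (Matrix.of fun k j => g k ((Fin.snoc z w : Fin (l + 1) → X) j)).submatrix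
          k.succAbove (Fin.last l).succAbove =
          Matrix.of fun (i j : Fin l) => g (k.succAbove i) (z j) := by
        ext i j
        simp
      rw [this]
      simp [c]
      ring

/-- A holomorphic function on a bounded connected set taking only finitely many
boundary values is constant. -/
theorem DiffContOnCl.subsingleton_image_of_finite_frontier {F : ℂ → ℂ} {Ω : Set ℂ}
    (hF : DiffContOnCl ℂ F Ω) (hΩb : Bornology.IsBounded Ω) (hΩc : IsPreconnected Ω)
    {S : Finset ℂ} (hS : ∀ z ∈ frontier Ω, F z ∈ S) : (F '' closure Ω).Subsingleton := by
  have hP : Differentiable ℂ (fun w : ℂ => ∏ s ∈ S, (w - s)) := by fun_prop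
  have hzero := Complex.eqOn_closure_of_eqOn_frontier hΩb (hP.comp_diffContOnCl hF)
    (diffContOnCl_const (c := (0 : ℂ)))
    (fun z hz => by simpa [Finset.prod_eq_zero_iff, sub_eq_zero] using hS z hz)
  have hsub : F '' closure Ω ⊆ S := by
    rintro _ ⟨z, hz, rfl⟩
    simpa [Finset.prod_eq_zero_iff, sub_eq_zero] using hzero hz
  have hpre : IsPreconnected (F '' closure Ω) := hΩc.closure.image F hF.continuousOn
  exact hpre.isDiscrete_iff_subsingleton.mp (S.finite_toSet.subset hsub).isDiscrete

theorem deriv_eq_complexPartial_of_re_eventuallyEq {f : ℂ → ℂ} {u : ℂ → ℝ} {z : ℂ}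
    (hf : DifferentiableAt ℂ f z) (hu : (fun w => (f w).re) =ᶠ[𝓝 z] u) :
    deriv f z = complexPartial u z := by
  have h := (hf.hasDerivAt.hasFDerivAt.restrictScalars ℝ)
  have h' := ((reCLM.hasFDerivAt.comp z h).congr_of_eventuallyEq hu.symm).fderiv
  rw [complexPartial, h']
  apply Complex.ext <;> simp

/-- A complex combination of real functions with vanishing conjugate-weighted
`∂`-derivative is holomorphic. -/
theorem differentiableAt_sum_conj_mul {ι : Type*} [Fintype ι] {u : ι → ℂ → ℝ} {c : ι → ℂ} {z : ℂ}
    (hu : ∀ k, DifferentiableAt ℝ (u k) z) (hc : ∑ k, c k * complexPartial (u k) z = 0) :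
    DifferentiableAt ℂ (fun w => ∑ k, (starRingEnd ℂ) (c k) * (u k w : ℂ)) z := by
  have hF : HasFDerivAt (fun w => ∑ k, (starRingEnd ℂ) (c k) * (u k w : ℂ))
      (∑ k, (starRingEnd ℂ) (c k) • (ofRealCLM.comp (fderiv ℝ (u k) z))) z :=
    HasFDerivAt.fun_sum fun k _ =>
      (ofRealCLM.hasFDerivAt.comp z (hu k).hasFDerivAt).const_smul ((starRingEnd ℂ) (c k))
  refine differentiableAt_complex_iff_differentiableAt_real.2 ⟨hF.differentiableAt, ?_⟩
  have h := congrArg (fun x => I * (starRingEnd ℂ) x) hc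
  rw [hF.fderiv]
  simp only [complexPartial, map_sum, map_mul, map_sub, conj_I, conj_ofReal, map_zero, mul_zero,
    Finset.mul_sum] at h
  simp only [sum_apply, smul_apply,
    ContinuousLinearMap.comp_apply, ofRealCLM_apply, smul_eq_mul, Finset.mul_sum]
  rw [eq_comm, ← sub_eq_zero, ← Finset.sum_sub_distrib, ← h]
  refine Finset.sum_congr rfl fun k _ => ?_
  linear_combination (-(starRingEnd ℂ) (c k) * (fderiv ℝ (u k) z I : ℂ)) * I_sq

theorem stmt0
    (n m : ℕ) (hn : 2 ≤ n) (hm : n - 1 ≤ m)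
    (Ω : Set ℂ) (hΩo : IsOpen Ω) (hΩc : IsConnected Ω) (hΩb : Bornology.IsBounded Ω)
    (Γ : ℕ → Set ℂ)
    (hΓ : frontier Ω = ⋃ k ∈ Finset.Icc 1 n, Γ k)
    (hΓclosed : ∀ k ∈ Finset.Icc 1 n, IsClosed (Γ k))
    (hΓne : ∀ k ∈ Finset.Icc 1 n, (Γ k).Nonempty)
    (hΓdisj : ∀ k ∈ Finset.Icc 1 n, ∀ l ∈ Finset.Icc 1 n, k ≠ l → Disjoint (Γ k) (Γ l))
    (u : ℕ → ℂ → ℝ)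
    (hu_cont : ∀ k ∈ Finset.Icc 1 (n - 1), ContinuousOn (u k) (closure Ω))
    (hu_harm : ∀ k ∈ Finset.Icc 1 (n - 1), HarmonicOnSet (u k) Ω)
    (hu_one : ∀ k ∈ Finset.Icc 1 (n - 1), ∀ z ∈ Γ k, u k z = 1)
    (hu_zero : ∀ k ∈ Finset.Icc 1 (n - 1), ∀ l ∈ Finset.Icc 1 n, l ≠ k → ∀ z ∈ Γ l, u k z = 0)
    (ztil : ℕ → ℂ) (hzΩ : ∀ j ∈ Finset.Icc 1 m, ztil j ∈ Ω)
    (hzdist : ∀ j ∈ Finset.Icc 1 m, ∀ j' ∈ Finset.Icc 1 m, j ≠ j' → ztil j ≠ ztil j')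
    (V : ℕ → Set ℂ)
    (hVopen : ∀ j ∈ Finset.Icc 1 m, IsOpen (V j))
    (hVconn : ∀ j ∈ Finset.Icc 1 m, IsConnected (V j))
    (hVsub : ∀ j ∈ Finset.Icc 1 m, V j ⊆ Ω)
    (hVdisj : ∀ j ∈ Finset.Icc 1 m, ∀ j' ∈ Finset.Icc 1 m, j ≠ j' → Disjoint (V j) (V j'))
    (hzV : ∀ j ∈ Finset.Icc 1 m, ztil j ∈ V j)
    (f : ℕ → ℂ → ℂ)
    (hf_holo : ∀ k ∈ Finset.Icc 1 (n - 1),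
      DifferentiableOn ℂ (f k) (⋃ j ∈ Finset.Icc 1 m, V j))
    (hf_re : ∀ k ∈ Finset.Icc 1 (n - 1), ∀ z ∈ ⋃ j ∈ Finset.Icc 1 m, V j,
      (f k z).re = u k z)
    (l : ℕ) (hl1 : 1 ≤ l) (hln : l ≤ n - 1) :
    ∃ z' : ℕ → ℂ, (∀ j ∈ Finset.Icc 1 l, z' j ∈ V j) ∧
      (Matrix.of fun k j : Fin l =>
        deriv (f ((k : ℕ) + 1)) (z' ((j : ℕ) + 1))).det ≠ 0 := by
  have hmem : ∀ k : Fin l, (k : ℕ) + 1 ∈ Finset.Icc 1 (n - 1) := fun k => by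
    rw [Finset.mem_Icc]; omega
  have hmemm : ∀ j : Fin l, (j : ℕ) + 1 ∈ Finset.Icc 1 m := fun j => by
    rw [Finset.mem_Icc]; omega
  have hmemn : ∀ j : Fin l, (j : ℕ) + 1 ∈ Finset.Icc 1 n := fun j => by
    rw [Finset.mem_Icc]; omega
  have hharm : ∀ k : Fin l, ∀ z ∈ Ω, InnerProductSpace.HarmonicAt (u (k + 1)) z :=
    fun k z hz => (hu_harm _ (hmem k)).harmonicAt hΩo hz
  have hUopen : IsOpen (⋃ j ∈ Finset.Icc 1 m, V j) := isOpen_biUnion fun j hj => hVopen j hj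
  have hderiv : ∀ k j : Fin l, ∀ z ∈ V (j + 1),
      deriv (f (k + 1)) z = complexPartial (u (k + 1)) z := by
    intro k j z hz
    have hzU : z ∈ ⋃ j ∈ Finset.Icc 1 m, V j := Set.mem_biUnion (hmemm j) hz
    refine deriv_eq_complexPartial_of_re_eventuallyEq
      ((hf_holo _ (hmem k)).differentiableAt (hUopen.mem_nhds hzU)) ?_
    filter_upwards [hUopen.mem_nhds hzU] with w hw using hf_re _ (hmem k) w hw
  obtain ⟨z, hzV', hz⟩ := exists_det_ne_zero_of_linearIndependent_on l
    (fun k => deriv (f (k + 1))) (fun j => V (j + 1)) (fun j c hc => by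
      have hG : AnalyticOnNhd ℂ (fun z => ∑ k, c k * complexPartial (u (k + 1)) z) Ω :=
        fun z hz => Finset.univ.analyticAt_fun_sum fun k _ =>
          analyticAt_const.mul (HarmonicAt.analyticAt_complex_partial (hharm k z hz))
      have hG0 := hG.eqOn_zero_of_preconnected_of_eventuallyEq_zero hΩc.isPreconnected
        (hzΩ _ (hmemm j)) (by
          filter_upwards [(hVopen _ (hmemm j)).mem_nhds (hzV _ (hmemm j))] with w hw
          rw [Pi.zero_apply, ← hc w hw]
          exact Finset.sum_congr rfl fun k _ => by rw [hderiv k j w hw])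
      let F : ℂ → ℂ := fun w => ∑ k : Fin l, (starRingEnd ℂ) (c k) * (u (k + 1) w : ℂ)
      have hF : DiffContOnCl ℂ F Ω := by
        refine ⟨fun w hw => (differentiableAt_sum_conj_mul
          (fun k => (hharm k w hw).1.differentiableAt (by norm_num))
          (hG0 hw)).differentiableWithinAt, ?_⟩
        exact continuousOn_finsetSum _ fun k _ => continuousOn_const.mul
          (continuous_ofReal.comp_continuousOn (hu_cont _ (hmem k)))
      have hFk : ∀ k : Fin l, ∀ w ∈ Γ (k + 1), F w = (starRingEnd ℂ) (c k) := by
        intro k w hw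
        simp only [F]
        rw [Finset.sum_eq_single k]
        · simp [hu_one _ (hmem k) w hw]
        · intro i _ hik
          simp [hu_zero _ (hmem i) _ (hmemn k) (fun h => hik (Fin.ext (by omega))) w hw]
        · simp
      have hF0 : ∀ p ∈ Finset.Icc 1 n, l < p → ∀ w ∈ Γ p, F w = 0 := by
        intro p hp hlp w hw
        exact Finset.sum_eq_zero fun i _ => by
          simp [hu_zero _ (hmem i) p hp (by omega) w hw]
      have hsub := hF.subsingleton_image_of_finite_frontier hΩb hΩc.isPreconnected
        (S := insert 0 (Finset.univ.image fun k => (starRingEnd ℂ) (c k))) (fun w hw => by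
          rw [hΓ] at hw
          obtain ⟨p, hp, hwp⟩ := Set.mem_iUnion₂.mp hw
          rcases lt_or_ge l p with hlp | hpl
          · simp [hF0 p hp hlp w hwp]
          · have hp1 := (Finset.mem_Icc.mp hp).1
            have := hFk ⟨p - 1, by omega⟩ w (by simpa [Nat.sub_add_cancel hp1] using hwp)
            simp [this])
      have hcl : ∀ p ∈ Finset.Icc 1 n, Γ p ⊆ closure Ω := fun p hp w hw =>
        frontier_subset_closure (hΓ ▸ Set.mem_biUnion hp hw)
      have hnn : n ∈ Finset.Icc 1 n := by rw [Finset.mem_Icc]; omega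
      obtain ⟨b, hb⟩ := hΓne n hnn
      funext k
      obtain ⟨a, ha⟩ := hΓne _ (hmemn k)
      have hab := hsub (Set.mem_image_of_mem F (hcl _ (hmemn k) ha))
        (Set.mem_image_of_mem F (hcl n hnn hb))
      rw [hFk k a ha, hF0 n hnn (by omega) b hb] at hab
      simpa using hab)
  refine ⟨fun j => if h : j - 1 < l then z ⟨j - 1, h⟩ else 0, fun j hj => ?_, ?_⟩
  · rw [Finset.mem_Icc] at hj
    have hlt : j - 1 < l := by omega
    have := hzV' ⟨j - 1, hlt⟩
    simp only [Nat.sub_add_cancel hj.1] at this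
    simpa [hlt] using this
  · simpa using hz
end

section
/- For each 1 ≤ j ≤ n−1 there exists a C^∞ closed curve γ : [0,1] → U with γ(0) = γ(1) such that the winding number of γ about every point of A_j equals 1, and the winding number of γ about every point of A_l equals 0 for every l ≠ j with 1 ≤ l ≤ n. -/
/-- The winding number of a loop `γ : ℝ → ℂ` (parametrized over `[0,1]`) about a
point `a`, given by `(2πi)⁻¹ ∫₀¹ γ'(t)/(γ(t) − a) dt`. -/
noncomputable def windingNumberLoop (γ : ℝ → ℂ) (a : ℂ) : ℂ :=
  (2 * Real.pi * Complex.I)⁻¹ * ∫ t in (0 : ℝ)..1, deriv γ t / (γ t - a)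

open Set Filter Topology

/-! ### Smooth paths and their logarithmic integrals -/

/-- There is a smooth path in `U` from `x` to `y`, constant outside `[0,1]`, whose integral of
`dz / (z - a)` is `g a` for every `a ∉ U`. -/
def HasSmoothPath (U : Set ℂ) (x y : ℂ) (g : ℂ → ℂ) : Prop :=
  ∃ γ : ℝ → ℂ, ContDiff ℝ (⊤ : ℕ∞) γ ∧ (∀ t ≤ 0, γ t = x) ∧ (∀ t, 1 ≤ t → γ t = y) ∧
    (∀ t, γ t ∈ U) ∧ ∀ a ∉ U, ∫ t in (0 : ℝ)..1, deriv γ t / (γ t - a) = g a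

/-- The integral of `dz / (z - a)` along the segment from `x` to `y`. -/
noncomputable def segmentLogIntegral (x y a : ℂ) : ℂ :=
  ∫ t in (0 : ℝ)..1, (y - x) / (x + t * (y - x) - a)

theorem deriv_eq_zero_of_eqOn_Iic {γ : ℝ → ℂ} {s t : ℝ} {x : ℂ} (hγ : Differentiable ℝ γ)
    (h : ∀ r ≤ s, γ r = x) (ht : t ≤ s) : deriv γ t = 0 := by
  rw [← (hγ t).derivWithin (uniqueDiffWithinAt_Iic t),
    derivWithin_congr (f := fun _ => x) (s := Iic t) (fun r hr => h r (le_trans hr ht)) (h t ht)]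
  simp

theorem deriv_eq_zero_of_eqOn_Ici {γ : ℝ → ℂ} {s t : ℝ} {x : ℂ} (hγ : Differentiable ℝ γ)
    (h : ∀ r, s ≤ r → γ r = x) (ht : s ≤ t) : deriv γ t = 0 := by
  rw [← (hγ t).derivWithin (uniqueDiffWithinAt_Ici t),
    derivWithin_congr (f := fun _ => x) (s := Ici t) (fun r hr => h r (le_trans ht hr)) (h t ht)]
  simp

theorem intervalIntegrable_deriv_div_sub {γ : ℝ → ℂ} (hγ : ContDiff ℝ (⊤ : ℕ∞) γ) {a : ℂ}
    {b c : ℝ} (h : ∀ t ∈ uIcc b c, γ t ≠ a) :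
    IntervalIntegrable (fun t => deriv γ t / (γ t - a)) MeasureTheory.volume b c :=
  ContinuousOn.intervalIntegrable <| (hγ.continuous_deriv (by simp)).continuousOn.div
    (hγ.continuous.sub continuous_const).continuousOn fun t ht => sub_ne_zero.2 (h t ht)

namespace HasSmoothPath

variable {U : Set ℂ} {x y z : ℂ} {g h : ℂ → ℂ}

theorem refl (hx : x ∈ U) : HasSmoothPath U x x 0 :=
  ⟨fun _ => x, contDiff_const, by simp, by simp, fun _ => hx, by simp⟩

theorem symm (H : HasSmoothPath U x y g) : HasSmoothPath U y x (-g) := by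
  obtain ⟨γ, hγ, h0, h1, hU, hg⟩ := H
  refine ⟨fun t => γ (1 - t), hγ.comp (contDiff_const.sub contDiff_id),
    fun t ht => h1 _ (by linarith), fun t ht => h0 _ (by linarith), fun t => hU _, fun a ha => ?_⟩
  have hd : ∀ t, deriv (fun t => γ (1 - t)) t = - deriv γ (1 - t) := fun t =>
    deriv_comp_const_sub (f := γ) 1 t
  simp only [hd, neg_div, intervalIntegral.integral_neg]
  rw [intervalIntegral.integral_comp_sub_left (fun t => deriv γ t / (γ t - a)) 1]
  simp [hg a ha]

theorem trans (H₁ : HasSmoothPath U x y g) (H₂ : HasSmoothPath U y z h) :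
    HasSmoothPath U x z (g + h) := by
  obtain ⟨γ, hγ, h0, h1, hU, hg⟩ := H₁
  obtain ⟨η, hη, k0, k1, kU, hh⟩ := H₂
  have dγ : Differentiable ℝ γ := hγ.differentiable (by simp)
  have dη : Differentiable ℝ η := hη.differentiable (by simp)
  set δ : ℝ → ℂ := fun t => γ (2 * t - 0) + η (2 * t - 1) - y with hδ
  have hδs : ContDiff ℝ (⊤ : ℕ∞) δ :=
    ((hγ.comp ((contDiff_const.mul contDiff_id).sub contDiff_const)).add
      (hη.comp ((contDiff_const.mul contDiff_id).sub contDiff_const))).sub contDiff_const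
  have left : ∀ t ≤ 1 / 2, δ t = γ (2 * t - 0) := fun t ht => by
    simp [hδ, k0 (2 * t - 1) (by linarith)]
  have right : ∀ t, 1 / 2 ≤ t → δ t = η (2 * t - 1) := fun t ht => by
    simp [hδ, h1 (2 * t) (by linarith)]
  have hd : ∀ t, deriv δ t = (2 : ℝ) • deriv γ (2 * t - 0) + (2 : ℝ) • deriv η (2 * t - 1) := by
    intro t
    have e : ∀ d : ℝ, HasDerivAt (fun t : ℝ => 2 * t - d) 2 t := fun d => by
      simpa using ((hasDerivAt_id t).const_mul 2).sub_const d
    exact ((((dγ _).hasDerivAt.scomp t (e 0)).add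
      ((dη _).hasDerivAt.scomp t (e 1))).sub_const y).deriv
  have hδU : ∀ t, δ t ∈ U := fun t => by
    rcases le_total t (1 / 2) with ht | ht
    · rw [left t ht]; exact hU _
    · rw [right t ht]; exact kU _
  refine ⟨δ, hδs, fun t ht => ?_, fun t ht => ?_, hδU, fun a ha => ?_⟩
  · rw [left t (by linarith)]; exact h0 _ (by linarith)
  · rw [right t (by linarith)]; exact k1 _ (by linarith)
  have hne : ∀ t, δ t ≠ a := fun t e => ha (e ▸ hδU t)
  rw [← intervalIntegral.integral_add_adjacent_intervals (b := 1 / 2)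
    (intervalIntegrable_deriv_div_sub hδs fun t _ => hne t)
    (intervalIntegrable_deriv_div_sub hδs fun t _ => hne t), Pi.add_apply, ← hg a ha, ← hh a ha]
  congr 1
  · trans (2 : ℝ) • ∫ t in (0 : ℝ)..1 / 2, (fun t => deriv γ t / (γ t - a)) (2 * t - 0)
    · rw [← intervalIntegral.integral_smul]
      refine intervalIntegral.integral_congr fun t ht => ?_
      rw [uIcc_of_le (by norm_num)] at ht
      have := deriv_eq_zero_of_eqOn_Iic (t := 2 * t - 1) dη k0 (by linarith [ht.2])
      simp only [hd, left t ht.2, this, smul_zero, add_zero, smul_div_assoc]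
    · rw [intervalIntegral.smul_integral_comp_mul_sub (fun t => deriv γ t / (γ t - a))]
      norm_num
  · trans (2 : ℝ) • ∫ t in (1 / 2 : ℝ)..1, (fun t => deriv η t / (η t - a)) (2 * t - 1)
    · rw [← intervalIntegral.integral_smul]
      refine intervalIntegral.integral_congr fun t ht => ?_
      rw [uIcc_of_le (by norm_num)] at ht
      have := deriv_eq_zero_of_eqOn_Ici (t := 2 * t - 0) dγ h1 (by linarith [ht.1])
      simp only [hd, right t ht.1, this, smul_zero, zero_add, smul_div_assoc]
    · rw [intervalIntegral.smul_integral_comp_mul_sub (fun t => deriv η t / (η t - a))]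
      norm_num

theorem of_segment (H : ∀ t ∈ Icc (0 : ℝ) 1, x + t * (y - x) ∈ U) :
    HasSmoothPath U x y (segmentLogIntegral x y) := by
  have hφ : ContDiff ℝ (⊤ : ℕ∞) Real.smoothTransition := Real.smoothTransition.contDiff
  have dφ : Differentiable ℝ Real.smoothTransition := hφ.differentiable (by simp)
  have hmem : ∀ t, Real.smoothTransition t ∈ Icc (0 : ℝ) 1 := fun t =>
    ⟨Real.smoothTransition.nonneg t, Real.smoothTransition.le_one t⟩
  refine ⟨fun t => x + Real.smoothTransition t * (y - x),
    contDiff_const.add ((Complex.ofRealCLM.contDiff.comp hφ).mul contDiff_const),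
    fun t ht => by simp [Real.smoothTransition.zero_of_nonpos ht],
    fun t ht => by simp [Real.smoothTransition.one_of_one_le ht],
    fun t => H _ (hmem t), fun a ha => ?_⟩
  have hd : ∀ t, deriv (fun t => x + Real.smoothTransition t * (y - x)) t
      = deriv Real.smoothTransition t * (y - x) := fun t =>
    (((dφ t).hasDerivAt.ofReal_comp.mul_const (y - x)).const_add x).deriv
  have := intervalIntegral.integral_deriv_smul_comp' (a := 0) (b := 1)
    (f := Real.smoothTransition) (f' := deriv Real.smoothTransition)
    (g := fun t : ℝ => (y - x) / (x + t * (y - x) - a)) (fun t _ => (dφ t).hasDerivAt)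
    (hφ.continuous_deriv (by simp)).continuousOn
    (ContinuousOn.div (by fun_prop) (by fun_prop) (by
      rintro _ ⟨t, -, rfl⟩ e
      exact ha (sub_eq_zero.1 e ▸ H _ (hmem t))))
  simp only [Real.smoothTransition.zero, Real.smoothTransition.one] at this
  rw [segmentLogIntegral, ← this]
  refine intervalIntegral.integral_congr fun t _ => ?_
  simp only [hd, Function.comp, Complex.real_smul, mul_div_assoc]

theorem exists_of_isPreconnected (hUo : IsOpen U) (hU : IsPreconnected U) (hx : x ∈ U)
    (hy : y ∈ U) : ∃ g, HasSmoothPath U x y g := by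
  refine hU.induction₂ (fun x y => ∃ g, HasSmoothPath U x y g) (fun x hx => ?_)
    (fun _ _ _ _ _ _ ⟨_, h₁⟩ ⟨_, h₂⟩ => ⟨_, h₁.trans h₂⟩) (fun _ _ _ _ ⟨_, h⟩ => ⟨_, h.symm⟩) hx hy
  obtain ⟨ε, hε, hball⟩ := Metric.isOpen_iff.1 hUo x hx
  filter_upwards [mem_nhdsWithin_of_mem_nhds (Metric.ball_mem_nhds x hε)] with y hy
  refine ⟨_, of_segment fun t ht => hball ?_⟩
  exact (convex_ball x ε).add_smul_sub_mem (Metric.mem_ball_self hε) hy ht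

/-- The logarithmic integrals of smooth loops in `U` based at `x`. -/
def loopIntegrals (hx : x ∈ U) : AddSubgroup (ℂ → ℂ) where
  carrier := {g | HasSmoothPath U x x g}
  zero_mem' := refl hx
  add_mem' := trans
  neg_mem' := symm

end HasSmoothPath

/-- The logarithmic integral of a smooth loop is constant on connected sets that the loop avoids. -/
theorem integral_deriv_div_sub_eq_of_isPreconnected {γ : ℝ → ℂ} (hγ : ContDiff ℝ (⊤ : ℕ∞) γ)
    (hloop : γ 0 = γ 1) {K : Set ℂ} (hK : IsPreconnected K) (hne : ∀ t ∈ Icc (0 : ℝ) 1, γ t ∉ K)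
    {a b : ℂ} (ha : a ∈ K) (hb : b ∈ K) :
    ∫ t in (0 : ℝ)..1, deriv γ t / (γ t - a) = ∫ t in (0 : ℝ)..1, deriv γ t / (γ t - b) := by
  refine hK.induction₂ (fun a b => ∫ t in (0 : ℝ)..1, deriv γ t / (γ t - a) =
    ∫ t in (0 : ℝ)..1, deriv γ t / (γ t - b)) (fun a ha => ?_)
    (fun _ _ _ _ _ _ h₁ h₂ => h₁.trans h₂) (fun _ _ _ _ h => h.symm) ha hb
  have hcl : IsClosed (γ '' Icc 0 1) := (isCompact_Icc.image hγ.continuous).isClosed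
  obtain ⟨ε, hε, hball⟩ := Metric.isOpen_iff.1 hcl.isOpen_compl a
    (by rintro ⟨t, ht, rfl⟩; exact hne t ht ha)
  filter_upwards [self_mem_nhdsWithin, mem_nhdsWithin_of_mem_nhds (Metric.ball_mem_nhds a hε)]
    with b hb hab
  have ne : ∀ c ∈ K, ∀ t ∈ uIcc (0 : ℝ) 1, γ t ≠ c := fun c hc t ht e =>
    hne t (by rwa [uIcc_of_le zero_le_one] at ht) (e ▸ hc)
  refine (sub_eq_zero.1 ?_).symm
  rw [← intervalIntegral.integral_sub (intervalIntegrable_deriv_div_sub hγ (ne b hb))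
    (intervalIntegrable_deriv_div_sub hγ (ne a ha)),
    intervalIntegral.integral_eq_sub_of_hasDerivAt
      (f := fun t => Complex.log ((γ t - b) / (γ t - a))) (fun t ht => ?_)
      ((intervalIntegrable_deriv_div_sub hγ (ne b hb)).sub
        (intervalIntegrable_deriv_div_sub hγ (ne a ha)))]
  · simp [hloop]
  have hd := (hγ.differentiable (by simp) t).hasDerivAt
  have ha' := sub_ne_zero.2 (ne a ha t ht)
  have hb' := sub_ne_zero.2 (ne b hb t ht)
  have hq : HasDerivAt (fun t => (γ t - b) / (γ t - a))
      ((deriv γ t * (γ t - a) - (γ t - b) * deriv γ t) / (γ t - a) ^ 2) t :=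
    (hd.sub_const b).div (hd.sub_const a) ha'
  refine (hq.clog_real ?_).congr_deriv ?_
  · have : (γ t - b) / (γ t - a) = 1 + (a - b) / (γ t - a) := by field_simp; ring
    rw [this]
    refine Complex.mem_slitPlane_of_norm_lt_one ?_
    have h1 : ε ≤ dist (γ t) a := by
      by_contra! hlt
      exact hball hlt ⟨t, by rwa [uIcc_of_le zero_le_one] at ht, rfl⟩
    rw [dist_eq_norm] at h1
    rw [norm_div, div_lt_one (hε.trans_le h1), norm_sub_rev, ← dist_eq_norm]
    exact lt_of_lt_of_le hab h1
  · field_simp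

theorem segmentLogIntegral_eq_log_sub_log {x y a w : ℂ}
    (h : ∀ t ∈ Icc (0 : ℝ) 1, w * (x + t * (y - x) - a) ∈ Complex.slitPlane) :
    segmentLogIntegral x y a = Complex.log (w * (y - a)) - Complex.log (w * (x - a)) := by
  rw [← uIcc_of_le zero_le_one] at h
  have hne : ∀ t ∈ uIcc (0 : ℝ) 1, x + t * (y - x) - a ≠ 0 := fun t ht =>
    right_ne_zero_of_mul (Complex.slitPlane_ne_zero (h t ht))
  have hint : IntervalIntegrable (fun t : ℝ => (y - x) / (x + t * (y - x) - a))
      MeasureTheory.volume 0 1 :=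
    ContinuousOn.intervalIntegrable (ContinuousOn.div (by fun_prop) (by fun_prop) hne)
  rw [segmentLogIntegral, intervalIntegral.integral_eq_sub_of_hasDerivAt
    (f := fun t : ℝ => Complex.log (w * (x + t * (y - x) - a))) (fun t ht => ?_) hint]
  · simp
  have hd : HasDerivAt (fun t : ℝ => w * (x + t * (y - x) - a)) (w * (y - x)) t := by
    simpa using ((((hasDerivAt_id t).ofReal_comp.mul_const (y - x)).const_add x).sub_const
      a).const_mul w
  refine (hd.clog_real (h t ht)).congr_deriv ?_
  rw [mul_div_mul_left _ _ (left_ne_zero_of_mul (Complex.slitPlane_ne_zero (h t ht)))]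

theorem segmentLogIntegral_eq_log {x y a q : ℂ} (hx : x ≠ a) (hy : y - a = q * (x - a))
    (hq : q.im ≠ 0) : segmentLogIntegral x y a = Complex.log q := by
  have hx' := sub_ne_zero.2 hx
  rw [segmentLogIntegral_eq_log_sub_log (w := (x - a)⁻¹), hy]
  · field_simp
    simp
  · intro t ht
    have : (x - a)⁻¹ * (x + t * (y - x) - a) = 1 + t * (q - 1) := by
      have : y - x = (q - 1) * (x - a) := by linear_combination hy
      rw [this]
      field_simp
      ring
    rw [this, Complex.mem_slitPlane_iff]
    rcases ht.1.eq_or_lt with rfl | h0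
    · simp
    · exact Or.inr (by simpa using ⟨h0.ne', hq⟩)

/-! ### Square grids -/

/-- The vertices of the square grid of side length `δ` in which `c` is the centre of a square. -/
noncomputable def gridVertex (c : ℂ) (δ : ℝ) (m : ℤ × ℤ) : ℂ :=
  ⟨c.re + δ * (m.1 - 1 / 2), c.im + δ * (m.2 - 1 / 2)⟩

/-- The closed square whose lower left vertex is `gridVertex c δ m`. -/
def gridSquare (c : ℂ) (δ : ℝ) (m : ℤ × ℤ) : Set ℂ :=
  Icc (c.re + δ * (m.1 - 1 / 2)) (c.re + δ * (m.1 + 1 / 2)) ×ℂ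
    Icc (c.im + δ * (m.2 - 1 / 2)) (c.im + δ * (m.2 + 1 / 2))

theorem convex_gridSquare (c : ℂ) (δ : ℝ) (m : ℤ × ℤ) : Convex ℝ (gridSquare c δ m) :=
  ((convex_Icc _ _).is_linear_preimage Complex.reLm.isLinear).inter
    ((convex_Icc _ _).is_linear_preimage Complex.imLm.isLinear)

theorem gridVertex_mem_gridSquare {c : ℂ} {δ : ℝ} (hδ : 0 < δ) {m k : ℤ × ℤ}
    (h₁ : k.1 = m.1 ∨ k.1 = m.1 + 1) (h₂ : k.2 = m.2 ∨ k.2 = m.2 + 1) :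
    gridVertex c δ k ∈ gridSquare c δ m := by
  simp only [gridSquare, gridVertex, Complex.mem_reProdIm, mem_Icc]
  rcases h₁ with h₁ | h₁ <;> rcases h₂ with h₂ | h₂ <;> rw [h₁, h₂] <;> push_cast <;>
    refine ⟨⟨?_, ?_⟩, ?_, ?_⟩ <;> nlinarith

theorem dist_le_of_mem_gridSquare {c z w : ℂ} {δ : ℝ} {m : ℤ × ℤ} (hz : z ∈ gridSquare c δ m)
    (hw : w ∈ gridSquare c δ m) : dist z w ≤ 2 * δ := by
  simp only [gridSquare, Complex.mem_reProdIm, mem_Icc] at hz hw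
  rw [dist_eq_norm]
  refine (Complex.norm_le_abs_re_add_abs_im _).trans ?_
  have h1 : |(z - w).re| ≤ δ := by rw [Complex.sub_re, abs_le]; constructor <;> linarith
  have h2 : |(z - w).im| ≤ δ := by rw [Complex.sub_im, abs_le]; constructor <;> linarith
  linarith

theorem center_mem_gridSquare_iff {c : ℂ} {δ : ℝ} (hδ : 0 < δ) {m : ℤ × ℤ} :
    c ∈ gridSquare c δ m ↔ m = 0 := by
  have key : ∀ k : ℤ, ∀ r : ℝ, r ∈ Icc (r + δ * (k - 1 / 2)) (r + δ * (k + 1 / 2)) ↔ k = 0 := by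
    refine fun k r => ⟨fun ⟨h1, h2⟩ => ?_, ?_⟩
    · have h3 : (k : ℝ) < 1 := by nlinarith
      have h4 : (-1 : ℝ) < k := by nlinarith
      norm_cast at h3 h4
      omega
    · rintro rfl
      constructor <;> push_cast <;> linarith
  rw [gridSquare, Complex.mem_reProdIm, key, key, Prod.ext_iff]
  rfl

theorem finite_gridSquare_inter_nonempty {c : ℂ} {δ : ℝ} (hδ : 0 < δ) {K : Set ℂ}
    (hK : Bornology.IsBounded K) : {m | (gridSquare c δ m ∩ K).Nonempty}.Finite := by
  obtain ⟨R, hR⟩ := hK.subset_closedBall c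
  obtain ⟨N, hN⟩ := exists_nat_ge (R / δ + 1)
  have hN' : R + δ ≤ δ * N := by
    have := mul_le_mul_of_nonneg_left hN hδ.le
    rwa [mul_add, mul_div_cancel₀ _ hδ.ne', mul_one] at this
  refine (finite_Icc ((-N, -N) : ℤ × ℤ) (N, N)).subset ?_
  rintro m ⟨z, hz, hzK⟩
  have hd : ‖z - c‖ ≤ R := by simpa [dist_eq_norm] using hR hzK
  have hre := abs_le.1 ((Complex.abs_re_le_norm _).trans hd)
  have him := abs_le.1 ((Complex.abs_im_le_norm _).trans hd)
  simp only [gridSquare, Complex.mem_reProdIm, mem_Icc, Complex.sub_re, Complex.sub_im]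
    at hz hre him
  have key : ∀ k : ℤ, -(R + δ) ≤ δ * k → δ * k ≤ R + δ → -(N : ℤ) ≤ k ∧ k ≤ N := by
    intro k h1 h2
    have h3 : (k : ℝ) ≤ N := le_of_mul_le_mul_left (h2.trans hN') hδ
    have h4 : -(N : ℝ) ≤ k := le_of_mul_le_mul_left (by linarith) hδ
    exact ⟨by exact_mod_cast h4, by exact_mod_cast h3⟩
  have h1 := key m.1 (by linarith) (by linarith)
  have h2 := key m.2 (by linarith) (by linarith)
  exact ⟨⟨h1.1, h2.1⟩, ⟨h1.2, h2.2⟩⟩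

/-- The integral of `dz / (z - a)` along the positively oriented boundary of a grid square. -/
noncomputable def squareLogIntegral (c : ℂ) (δ : ℝ) (m : ℤ × ℤ) (a : ℂ) : ℂ :=
  segmentLogIntegral (gridVertex c δ m) (gridVertex c δ (m + (1, 0))) a
    - segmentLogIntegral (gridVertex c δ (m + (0, 1))) (gridVertex c δ (m + (0, 1) + (1, 0))) a
    - (segmentLogIntegral (gridVertex c δ m) (gridVertex c δ (m + (0, 1))) a
    - segmentLogIntegral (gridVertex c δ (m + (1, 0))) (gridVertex c δ (m + (1, 0) + (0, 1))) a)

theorem squareLogIntegral_eq_zero {c a : ℂ} {δ : ℝ} (hδ : 0 < δ) {m : ℤ × ℤ}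
    (ha : a ∉ gridSquare c δ m) : squareLogIntegral c δ m a = 0 := by
  obtain ⟨w, hw⟩ : ∃ w : ℂ, ∀ z ∈ gridSquare c δ m, 0 < (w * (z - a)).re := by
    simp only [gridSquare, Complex.mem_reProdIm, mem_Icc, not_and_or, not_le] at ha
    rcases ha with (h | h) | (h | h)
    · exact ⟨1, fun z hz => by have := hz.1.1; simp; linarith⟩
    · exact ⟨-1, fun z hz => by have := hz.1.2; simp; linarith⟩
    · exact ⟨-Complex.I, fun z hz => by have := hz.2.1; simp; linarith⟩
    · exact ⟨Complex.I, fun z hz => by have := hz.2.2; simp; linarith⟩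
  have key : ∀ x ∈ gridSquare c δ m, ∀ y ∈ gridSquare c δ m,
      segmentLogIntegral x y a = Complex.log (w * (y - a)) - Complex.log (w * (x - a)) :=
    fun x hx y hy => segmentLogIntegral_eq_log_sub_log fun t ht => Or.inl <| hw _ <|
      (convex_gridSquare c δ m).add_smul_sub_mem hx hy ht
  have h00 : gridVertex c δ m ∈ gridSquare c δ m := gridVertex_mem_gridSquare hδ (by simp) (by simp)
  have h10 : gridVertex c δ (m + (1, 0)) ∈ gridSquare c δ m :=
    gridVertex_mem_gridSquare hδ (by simp) (by simp)
  have h01 : gridVertex c δ (m + (0, 1)) ∈ gridSquare c δ m :=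
    gridVertex_mem_gridSquare hδ (by simp) (by simp)
  have h11 : gridVertex c δ (m + (0, 1) + (1, 0)) ∈ gridSquare c δ m :=
    gridVertex_mem_gridSquare hδ (by simp) (by simp)
  rw [squareLogIntegral, add_right_comm m (1, 0), key _ h00 _ h10, key _ h01 _ h11,
    key _ h00 _ h01, key _ h10 _ h11]
  ring

theorem squareLogIntegral_zero_center (c : ℂ) {δ : ℝ} (hδ : 0 < δ) :
    squareLogIntegral c δ 0 c = 2 * Real.pi * Complex.I := by
  have hne : ∀ m, gridVertex c δ m ≠ c := by
    intro m h
    have h1 := congrArg Complex.re h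
    have h2 : δ * (2 * m.1 - 1) = 0 := by simp [gridVertex] at h1 ⊢; grind
    have h3 : (2 * m.1 - 1 : ℝ) = 0 := (mul_eq_zero.1 h2).resolve_left hδ.ne'
    norm_cast at h3
    omega
  rw [squareLogIntegral, segmentLogIntegral_eq_log (q := Complex.I) (hne _) _ (by simp),
    segmentLogIntegral_eq_log (q := -Complex.I) (hne _) _ (by simp),
    segmentLogIntegral_eq_log (q := -Complex.I) (hne _) _ (by simp),
    segmentLogIntegral_eq_log (q := Complex.I) (hne _) _ (by simp),
    Complex.log_I, Complex.log_neg_I]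
  · ring
  all_goals
    apply Complex.ext <;> simp [gridVertex] <;> ring_nf <;> simp

theorem sum_sub_translate_mem {ι M : Type*} [AddGroup ι] [AddCommGroup M] (G : AddSubgroup M)
    (S : Finset ι) (e : ι) (f : ι → M) (h₁ : ∀ m ∈ S, m - e ∉ S → f m ∈ G)
    (h₂ : ∀ m ∉ S, m - e ∈ S → f m ∈ G) : ∑ m ∈ S, (f m - f (m + e)) ∈ G := by
  classical
  have : ∑ m ∈ S, f (m + e) = ∑ m ∈ S.map (Equiv.addRight e).toEmbedding, f m := by simp
  rw [Finset.sum_sub_distrib, this, ← Finset.sum_sdiff_sub_sum_sdiff]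
  have hmem : ∀ m, m ∈ S.map (Equiv.addRight e).toEmbedding ↔ m - e ∈ S := by
    simp [Finset.mem_map_equiv, sub_eq_add_neg]
  refine sub_mem (sum_mem fun m hm => ?_) (sum_mem fun m hm => ?_) <;>
    rw [Finset.mem_sdiff, hmem] at hm
  · exact h₁ m hm.1 hm.2
  · exact h₂ m hm.2 hm.1

/-- If `K` is compact with an open neighbourhood `W` such that `W \ K ⊆ U`, then some smooth loop in
the connected open set `U` winds once around a given point of `K` and not around points
outside `W`. -/
theorem exists_loop_around_compact {U K W : Set ℂ} (hUo : IsOpen U) (hU : IsConnected U)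
    (hK : IsCompact K) (hW : IsOpen W) (hKW : K ⊆ W) (hWU : W \ K ⊆ U) {c : ℂ} (hc : c ∈ K) :
    ∃ x g, HasSmoothPath U x x g ∧ g c = 2 * Real.pi * Complex.I ∧ ∀ a ∉ W, g a = 0 := by
  obtain ⟨x, hx⟩ := hU.nonempty
  obtain ⟨ε, hε, hεW⟩ := hK.exists_thickening_subset_open hW hKW
  obtain ⟨δ, hδ, hδε⟩ : ∃ δ : ℝ, 0 < δ ∧ 2 * δ < ε := ⟨ε / 3, by positivity, by linarith⟩
  have hfin := finite_gridSquare_inter_nonempty (c := c) hδ hK.isBounded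
  set S := hfin.toFinset with hS
  have hmemS : ∀ m, m ∈ S ↔ (gridSquare c δ m ∩ K).Nonempty := by simp [hS]
  have hSW : ∀ m ∈ S, gridSquare c δ m ⊆ W := fun m hm z hz => by
    obtain ⟨w, hw, hwK⟩ := (hmemS m).1 hm
    exact hεW (Metric.mem_thickening_iff.2
      ⟨w, hwK, (dist_le_of_mem_gridSquare hz hw).trans_lt hδε⟩)
  have hP : ∀ m, ∃ g, gridVertex c δ m ∈ U → HasSmoothPath U x (gridVertex c δ m) g := fun m => by
    by_cases hm : gridVertex c δ m ∈ U
    · obtain ⟨g, hg⟩ := HasSmoothPath.exists_of_isPreconnected hUo hU.isPreconnected hx hm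
      exact ⟨g, fun _ => hg⟩
    · exact ⟨0, fun h => absurd h hm⟩
  choose P hP using hP
  set F : ℤ × ℤ → ℤ × ℤ → ℂ → ℂ := fun d m =>
    P m + segmentLogIntegral (gridVertex c δ m) (gridVertex c δ (m + d)) - P (m + d) with hF
  have hedge : ∀ d m k l, gridVertex c δ m ∈ gridSquare c δ k ∩ gridSquare c δ l →
      gridVertex c δ (m + d) ∈ gridSquare c δ k ∩ gridSquare c δ l → k ∈ S → l ∉ S →
      F d m ∈ HasSmoothPath.loopIntegrals hx := by
    intro d m k l hm hmd hk hl
    have hsub : gridSquare c δ k ∩ gridSquare c δ l ⊆ U := fun z hz =>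
      hWU ⟨hSW k hk hz.1, fun hzK => hl ((hmemS l).2 ⟨z, hz.2, hzK⟩)⟩
    have hconv := (convex_gridSquare c δ k).inter (convex_gridSquare c δ l)
    have hseg := HasSmoothPath.of_segment fun t ht =>
      hsub (hconv.add_smul_sub_mem hm hmd ht)
    rw [hF]
    simp only [sub_eq_add_neg]
    exact ((hP m (hsub hm)).trans hseg).trans (hP _ (hsub hmd)).symm
  have hH := sum_sub_translate_mem (HasSmoothPath.loopIntegrals hx) S (0, 1) (F (1, 0))
    (fun m hm hm' => hedge _ _ m (m - (0, 1))
      (by constructor <;> refine gridVertex_mem_gridSquare hδ ?_ ?_ <;> simp)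
      (by constructor <;> refine gridVertex_mem_gridSquare hδ ?_ ?_ <;> simp) hm hm')
    (fun m hm hm' => hedge _ _ (m - (0, 1)) m
      (by constructor <;> refine gridVertex_mem_gridSquare hδ ?_ ?_ <;> simp)
      (by constructor <;> refine gridVertex_mem_gridSquare hδ ?_ ?_ <;> simp) hm' hm)
  have hV := sum_sub_translate_mem (HasSmoothPath.loopIntegrals hx) S (1, 0) (F (0, 1))
    (fun m hm hm' => hedge _ _ m (m - (1, 0))
      (by constructor <;> refine gridVertex_mem_gridSquare hδ ?_ ?_ <;> simp)
      (by constructor <;> refine gridVertex_mem_gridSquare hδ ?_ ?_ <;> simp) hm hm')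
    (fun m hm hm' => hedge _ _ (m - (1, 0)) m
      (by constructor <;> refine gridVertex_mem_gridSquare hδ ?_ ?_ <;> simp)
      (by constructor <;> refine gridVertex_mem_gridSquare hδ ?_ ?_ <;> simp) hm' hm)
  have htotal := sub_mem hH hV
  rw [← Finset.sum_sub_distrib] at htotal
  have heval : ∀ a, (∑ m ∈ S, (F (1, 0) m - F (1, 0) (m + (0, 1)) -
      (F (0, 1) m - F (0, 1) (m + (1, 0))))) a = ∑ m ∈ S, squareLogIntegral c δ m a := by
    intro a
    rw [Finset.sum_apply]
    refine Finset.sum_congr rfl fun m _ => ?_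
    simp only [hF, squareLogIntegral, Pi.sub_apply, Pi.add_apply, add_right_comm m (1, 0)]
    ring
  refine ⟨x, _, htotal, ?_, fun a ha => ?_⟩
  · rw [heval, Finset.sum_eq_single 0, squareLogIntegral_zero_center c hδ]
    · exact fun m _ hm => squareLogIntegral_eq_zero hδ (mt (center_mem_gridSquare_iff hδ).1 hm)
    · exact fun h => absurd ((hmemS 0).2 ⟨c, (center_mem_gridSquare_iff hδ).2 rfl, hc⟩) h
  · rw [heval]
    exact Finset.sum_eq_zero fun m hm => squareLogIntegral_eq_zero hδ fun h => ha (hSW m hm h)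

theorem isPreconnected_setOf_lt_norm (R : ℝ) : IsPreconnected {z : ℂ | R < ‖z‖} := by
  have : {z : ℂ | R < ‖z‖} =
      (fun p : ℝ × ℝ => (p.1 * Complex.exp (p.2 * Complex.I) : ℂ)) '' (Ioi R ×ˢ univ) := by
    ext z
    constructor
    · exact fun hz => ⟨(‖z‖, z.arg), ⟨hz, trivial⟩, Complex.norm_mul_exp_arg_mul_I z⟩
    · rintro ⟨p, ⟨hp, -⟩, rfl⟩
      have hp : R < p.1 := hp
      simpa [Complex.norm_exp_ofReal_mul_I] using hp.trans_le (le_abs_self _)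
  rw [this]
  exact (isPreconnected_Ioi.prod isPreconnected_univ).image _ (by fun_prop)

/-- If two disjoint closed sets cover the complement of a bounded set and one of them is unbounded,
then the other one is bounded. -/
theorem isBounded_of_compl_eq_union {U A B : Set ℂ} (hU : Bornology.IsBounded U)
    (hA : IsClosed A) (hB : IsClosed B) (hAB : Disjoint A B) (hcompl : Uᶜ ⊆ A ∪ B)
    (hA' : ¬ Bornology.IsBounded A) : Bornology.IsBounded B := by
  obtain ⟨R, hUR⟩ := hU.subset_closedBall 0
  have hsub : {z : ℂ | R < ‖z‖} ⊆ A ∪ B := fun z hz => hcompl fun hzU => by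
    have : ‖z‖ ≤ R := by simpa using hUR hzU
    exact absurd hz this.not_gt
  rcases isPreconnected_iff_subset_of_disjoint_closed.1 (isPreconnected_setOf_lt_norm R) A B hA
    hB hsub (by rw [hAB.inter_eq, inter_empty]) with h | h
  · refine (Metric.isBounded_closedBall (x := 0) (r := R)).subset fun z hz => ?_
    by_contra hzR
    exact hAB.notMem_of_mem_right hz (h (by simpa using hzR))
  · refine absurd ((Metric.isBounded_closedBall (x := 0) (r := R)).subset
      fun z hz => ?_) hA'
    by_contra hzR
    exact hAB.notMem_of_mem_left hz (h (by simpa using hzR))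

theorem stmt1
    (n : ℕ) (hn : 1 ≤ n)
    (U : Set ℂ) (hUo : IsOpen U) (hUc : IsConnected U) (hUb : Bornology.IsBounded U)
    (A : ℕ → Set ℂ)
    (hA : Uᶜ = ⋃ j ∈ Finset.Icc 1 n, A j)
    (hAclosed : ∀ j ∈ Finset.Icc 1 n, IsClosed (A j))
    (hAne : ∀ j ∈ Finset.Icc 1 n, (A j).Nonempty)
    (hAconn : ∀ j ∈ Finset.Icc 1 n, IsConnected (A j))
    (hAdisj : ∀ j ∈ Finset.Icc 1 n, ∀ l ∈ Finset.Icc 1 n, j ≠ l → Disjoint (A j) (A l))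
    (hAn : ¬ Bornology.IsBounded (A n))
    (j : ℕ) (hj1 : 1 ≤ j) (hjn : j ≤ n - 1) :
    ∃ γ : ℝ → ℂ, ContDiff ℝ (⊤ : ℕ∞) γ ∧ γ 0 = γ 1 ∧
      (∀ t ∈ Set.Icc (0 : ℝ) 1, γ t ∈ U) ∧
      (∀ a ∈ A j, windingNumberLoop γ a = 1) ∧
      (∀ l ∈ Finset.Icc 1 n, l ≠ j → ∀ a ∈ A l, windingNumberLoop γ a = 0) := by
  classical
  have hj : j ∈ Finset.Icc 1 n := Finset.mem_Icc.2 ⟨hj1, by omega⟩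
  have hn' : n ∈ Finset.Icc 1 n := Finset.mem_Icc.2 ⟨hn, le_rfl⟩
  have hjn' : j ≠ n := by omega
  set B : Set ℂ := ⋃ l ∈ (Finset.Icc 1 n).erase j, A l with hB
  have hBclosed : IsClosed B :=
    isClosed_biUnion_finset fun l hl => hAclosed l (Finset.mem_of_mem_erase hl)
  have hsubB : ∀ l ∈ Finset.Icc 1 n, l ≠ j → A l ⊆ B := fun l hl hlj =>
    subset_biUnion_of_mem (u := A) (s := ((Finset.Icc 1 n).erase j : Set ℕ)) (by simp_all)
  have hdisj : Disjoint B (A j) := by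
    simp only [hB, disjoint_iUnion_left]
    exact fun l hl => hAdisj l (Finset.mem_of_mem_erase hl) j hj (Finset.ne_of_mem_erase hl)
  have hcompl : Uᶜ = B ∪ A j := by
    rw [hA, hB, ← Finset.insert_erase hj, Finset.set_biUnion_insert, union_comm]
    simp
  have hbdd : Bornology.IsBounded (A j) :=
    isBounded_of_compl_eq_union hUb hBclosed (hAclosed j hj) hdisj hcompl.subset
      fun h => hAn (h.subset (hsubB n hn' hjn'.symm))
  obtain ⟨c, hc⟩ := hAne j hj
  obtain ⟨x, g, ⟨γ, hγ, h0, h1, hγU, hγg⟩, hgc, hgB⟩ :=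
    exists_loop_around_compact hUo hUc (Metric.isCompact_of_isClosed_isBounded (hAclosed j hj) hbdd)
      hBclosed.isOpen_compl hdisj.symm.subset_compl_right
      (fun z hz => by
        by_contra hzU
        exact (hcompl.subset hzU).elim hz.1 hz.2) hc
  have hloop : γ 0 = γ 1 := by rw [h0 0 le_rfl, h1 1 le_rfl]
  have hnotU : ∀ a ∈ B ∪ A j, a ∉ U := fun a ha => hcompl.superset ha
  refine ⟨γ, hγ, hloop, fun t _ => hγU t, fun a ha => ?_, fun l hl hlj a ha => ?_⟩
  · rw [windingNumberLoop, integral_deriv_div_sub_eq_of_isPreconnected hγ hloop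
      (hAconn j hj).isPreconnected (fun t _ h => hnotU _ (Or.inr h) (hγU t)) ha hc,
      hγg c (hnotU c (Or.inr hc)), hgc]
    exact inv_mul_cancel₀ Complex.two_pi_I_ne_zero
  · have haB := hsubB l hl hlj ha
    rw [windingNumberLoop, hγg a (hnotU a (Or.inl haB)), hgB a (fun h => h haB), mul_zero]
end

section
/- Suppose that h(z) is irrational for every point z ∈ D all of whose coordinates have rational real parts (i.e. Re z_j ∈ ℚ for all 1 ≤ j ≤ k). Then for every 1 ≤ j ≤ k the partial derivative ∂h/∂y_j (the derivative of h in the direction of i·e_j, where e_j is the j-th standard basis vector) vanishes identically on D. -/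
open Topology Filter

/-- A continuous real function with only irrational values is constant on preconnected sets. -/
theorem IsPreconnected.eq_of_irrational {X : Type*} [TopologicalSpace X] {s : Set X}
    (hs : IsPreconnected s) {g : X → ℝ} (hg : ContinuousOn g s)
    (hirr : ∀ x ∈ s, Irrational (g x)) {x y : X} (hx : x ∈ s) (hy : y ∈ s) : g x = g y := by
  have key : ∀ {x y : X}, x ∈ s → y ∈ s → ¬ g x < g y := by
    intro x y hx hy hlt
    obtain ⟨q, hq₁, hq₂⟩ := exists_rat_btwn hlt
    obtain ⟨w, hw, hwq⟩ := hs.intermediate_value hx hy hg ⟨hq₁.le, hq₂.le⟩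
    exact hirr w hw ⟨q, hwq.symm⟩
  exact le_antisymm (not_lt.mp (key hy hx)) (not_lt.mp (key hx hy))

/-- Points all of whose coordinates have rational real part are dense. -/
theorem dense_forall_re_rational (ι : Type*) :
    Dense {z : ι → ℂ | ∀ j, ∃ q : ℚ, (z j).re = (q : ℝ)} := by
  have h : Dense {c : ℂ | ∃ q : ℚ, c.re = (q : ℝ)} := by
    convert Rat.isDenseEmbedding_coe_real.dense.preimage Complex.isOpenMap_re using 1
    ext c
    simp [eq_comm]
  simpa [Set.pi] using dense_pi Set.univ fun (_ : ι) _ => h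

theorem stmt5
    (k : ℕ) (hk : 0 < k)
    (D : Set (Fin k → ℂ)) (hD : D.Nonempty) (hDo : IsOpen D)
    (F : (Fin k → ℂ) → ℂ) (hF : DifferentiableOn ℂ F D)
    (hirr : ∀ z ∈ D, (∀ j : Fin k, ∃ q : ℚ, (z j).re = (q : ℝ)) →
      Irrational ((F z).re))
    (j : Fin k) :
    ∀ z ∈ D,
      fderiv ℝ (fun w => (F w).re) z (Pi.single j Complex.I) = 0 := by
  intro z hz
  set h : (Fin k → ℂ) → ℝ := fun w => (F w).re
  set v : Fin k → ℂ := Pi.single j Complex.I with hv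
  have hv_norm : ‖v‖ = 1 := by rw [hv, Pi.norm_single, Complex.norm_I]
  have hcont : ContinuousOn h D := Complex.continuous_re.comp_continuousOn hF.continuousOn
  have hdiff : DifferentiableAt ℝ h z :=
    Complex.reCLM.differentiableAt.comp z
      ((hF.differentiableAt (hDo.mem_nhds hz)).restrictScalars ℝ)
  obtain ⟨r, hr, hball⟩ := Metric.isOpen_iff.mp hDo z hz
  have hmem : ∀ w ∈ Metric.ball z (r / 2), ∀ t ∈ Metric.ball (0 : ℝ) (r / 2),
      w + t • v ∈ D := by
    intro w hw t ht
    apply hball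
    rw [mem_ball_iff_norm] at hw ⊢
    rw [mem_ball_zero_iff] at ht
    calc ‖w + t • v - z‖ = ‖(w - z) + t • v‖ := by congr 1; abel
      _ ≤ ‖w - z‖ + ‖t • v‖ := norm_add_le _ _
      _ < r := by rw [norm_smul, hv_norm]; linarith
  have hconst_rat : ∀ w ∈ Metric.ball z (r / 2), (∀ i, ∃ q : ℚ, (w i).re = (q : ℝ)) →
      ∀ t ∈ Metric.ball (0 : ℝ) (r / 2), h (w + t • v) = h w := by
    intro w hw hwq t ht
    have := (convex_ball (0 : ℝ) (r / 2)).isPreconnected.eq_of_irrational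
      (g := fun t : ℝ => h (w + t • v))
      (hcont.comp (by fun_prop) (hmem w hw))
      (fun t ht => hirr _ (hmem w hw t ht) fun i => by
        obtain ⟨q, hq⟩ := hwq i
        refine ⟨q, ?_⟩
        rcases eq_or_ne i j with rfl | hij
        · simp [hv, hq]
        · simp [hv, hq, hij])
      ht (Metric.mem_ball_self (half_pos hr))
    simpa using this
  have hconst : ∀ t ∈ Metric.ball (0 : ℝ) (r / 2), h (z + t • v) = h z := by
    intro t ht
    have hzt := hmem z (Metric.mem_ball_self (half_pos hr)) t ht
    set S := {w : Fin k → ℂ | ∀ i, ∃ q : ℚ, (w i).re = (q : ℝ)}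
    have : (𝓝[S] z).NeBot :=
      mem_closure_iff_nhdsWithin_neBot.mp (dense_forall_re_rational (Fin k) z)
    have h₁ : ContinuousAt (fun w => h (w + t • v)) z :=
      ContinuousAt.comp (f := fun w => w + t • v) (hcont.continuousAt (hDo.mem_nhds hzt))
        (by fun_prop)
    have h₂ : ContinuousAt h z := hcont.continuousAt (hDo.mem_nhds hz)
    refine tendsto_nhds_unique_of_eventuallyEq (l := 𝓝[S] z) (h₁.mono_left nhdsWithin_le_nhds)
      (h₂.mono_left nhdsWithin_le_nhds) ?_
    filter_upwards [self_mem_nhdsWithin,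
      nhdsWithin_le_nhds (Metric.ball_mem_nhds z (half_pos hr))] with w hwq hw
    exact hconst_rat w hw hwq t ht
  rw [← hdiff.lineDeriv_eq_fderiv, lineDeriv]
  have heq : (fun t : ℝ => h (z + t • v)) =ᶠ[𝓝 0] fun _ => h z := by
    filter_upwards [Metric.ball_mem_nhds (0 : ℝ) (half_pos hr)] with t ht using hconst t ht
  rw [heq.deriv_eq, deriv_const]
end
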